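/- For every real β > -1, every natural number n ≥ 1, and every real x ≥ 0, one has ∫₀^x t^{β} e^{-t} L_n^{β}(t) dt = (1/n) · x^{β+1} e^{-x} L_{n-1}^{β+1}(x). -/

import Mathlib

open Real MeasureTheory

/-- The generalized Laguerre polynomial
`L_n^μ(x) = ∑_{k=0}^{n} Γ(n+μ+1)/(Γ(μ+k+1)·(n-k)!) · (-x)^k / k!`. -/
noncomputable def genLaguerre (μ : ℝ) (n : ℕ) (x : ℝ) : ℝ :=
  ∑ k ∈ Finset.range (n + 1),
    Real.Gamma (n + μ + 1) / (Real.Gamma (μ + k + 1) * (Nat.factorial (n - k) : ℝ)) *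
      ((-x) ^ k / (Nat.factorial k : ℝ))

theorem continuous_genLaguerre (μ : ℝ) (n : ℕ) : Continuous (genLaguerre μ n) := by
  unfold genLaguerre
  fun_prop

theorem hasDerivAt_genLaguerre (μ : ℝ) (n : ℕ) (x : ℝ) :
    HasDerivAt (genLaguerre μ n)
      (∑ k ∈ Finset.range (n + 1),
        Real.Gamma (n + μ + 1) / (Real.Gamma (μ + k + 1) * (Nat.factorial (n - k) : ℝ)) *
          ((k * (-x) ^ (k - 1) * (-1)) / (Nat.factorial k : ℝ))) x := by
  unfold genLaguerre
  refine HasDerivAt.fun_sum fun k _ => ?_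
  exact ((((hasDerivAt_id x).neg).pow k).div_const _).const_mul _

/-- The differential relation
`(β + 1 - x) L_m^{β+1}(x) + x (L_m^{β+1})'(x) = (m + 1) L_{m+1}^β(x)`. -/
theorem genLaguerre_differential_relation {β : ℝ} (hβ : -1 < β) (m : ℕ) (x : ℝ) :
    (β + 1 - x) * genLaguerre (β + 1) m x + x * deriv (genLaguerre (β + 1) m) x =
      (m + 1) * genLaguerre β (m + 1) x := by
  rw [(hasDerivAt_genLaguerre (β + 1) m x).deriv]
  unfold genLaguerre
  have split : ∀ b : ℕ → ℝ, (m + 1 : ℝ) * ∑ k ∈ Finset.range (m + 1 + 1), b k =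
      ∑ k ∈ Finset.range (m + 1), ((m + 1 - k) * b k + (k + 1) * b (k + 1)) := by
    intro b
    have h₁ : ∑ k ∈ Finset.range (m + 1 + 1), (m + 1 - k : ℝ) * b k =
        ∑ k ∈ Finset.range (m + 1), (m + 1 - k : ℝ) * b k := by
      rw [Finset.sum_range_succ]; simp
    have h₂ : ∑ k ∈ Finset.range (m + 1 + 1), (k : ℝ) * b k =
        ∑ k ∈ Finset.range (m + 1), (k + 1 : ℝ) * b (k + 1) := by
      rw [Finset.sum_range_succ']; simp
    rw [Finset.sum_add_distrib, ← h₁, ← h₂, ← Finset.sum_add_distrib, Finset.mul_sum]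
    exact Finset.sum_congr rfl fun k _ => by ring
  rw [split, Finset.mul_sum, Finset.mul_sum, ← Finset.sum_add_distrib]
  refine Finset.sum_congr rfl fun k hk => ?_
  obtain ⟨j, rfl⟩ := Nat.exists_eq_add_of_le (Nat.lt_succ_iff.mp (Finset.mem_range.mp hk))
  have hpos : 0 < β + k + 1 := by
    have : (0 : ℝ) ≤ k := k.cast_nonneg
    linarith
  have hΓ : Real.Gamma (β + 1 + k + 1) = (β + k + 1) * Real.Gamma (β + k + 1) := by
    rw [← Real.Gamma_add_one hpos.ne']; ring_nf
  have hΓ₀ : Real.Gamma (β + k + 1) ≠ 0 := (Real.Gamma_pos_of_pos hpos).ne'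
  have hpow : x * (k * (-x) ^ (k - 1) * (-1)) = k * (-x) ^ k := by
    cases k with
    | zero => simp
    | succ i => rw [Nat.add_sub_cancel, pow_succ]; ring
  have e₁ : k + j - k = j := by omega
  have e₂ : k + j + 1 - k = j + 1 := by omega
  have e₃ : k + j + 1 - (k + 1) = j := by omega
  have e₄ : ((k + j + 1 : ℕ) : ℝ) + β + 1 = ((k + j : ℕ) : ℝ) + (β + 1) + 1 := by
    push_cast; ring
  have e₅ : β + ((k + 1 : ℕ) : ℝ) + 1 = β + 1 + k + 1 := by push_cast; ring
  rw [e₁, e₂, e₃, e₄, e₅, hΓ, mul_left_comm x, ← mul_div_assoc x, hpow, Nat.factorial_succ j,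
    Nat.factorial_succ k, pow_succ]
  have hj : (Nat.factorial j : ℝ) ≠ 0 := by positivity
  have hk' : (Nat.factorial k : ℝ) ≠ 0 := by positivity
  have hj₁ : (j + 1 : ℝ) ≠ 0 := by positivity
  have hk₁ : (k + 1 : ℝ) ≠ 0 := by positivity
  have hp := hpos.ne'
  generalize Real.Gamma (((k + j : ℕ) : ℝ) + (β + 1) + 1) = G
  push_cast
  field_simp
  ring

theorem hasDerivAt_rpow_mul_exp_mul_genLaguerre {β : ℝ} (hβ : -1 < β) (m : ℕ) {t : ℝ}
    (ht : 0 < t) :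
    HasDerivAt (fun t => t ^ (β + 1) * Real.exp (-t) * genLaguerre (β + 1) m t)
      ((m + 1) * (t ^ β * Real.exp (-t) * genLaguerre β (m + 1) t)) t := by
  have hL := (hasDerivAt_genLaguerre (β + 1) m t).differentiableAt.hasDerivAt
  have hpow : HasDerivAt (fun t : ℝ => t ^ (β + 1)) ((β + 1) * t ^ β) t := by
    simpa using Real.hasDerivAt_rpow_const (p := β + 1) (Or.inl ht.ne')
  have hexp : HasDerivAt (fun t : ℝ => Real.exp (-t)) (Real.exp (-t) * (-1)) t :=
    (hasDerivAt_neg t).exp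
  refine ((hpow.mul hexp).mul hL).congr_deriv ?_
  rw [Pi.mul_apply, Real.rpow_add_one ht.ne']
  linear_combination (t ^ β * Real.exp (-t)) * genLaguerre_differential_relation hβ m t

/-- For `β > -1`, `n ≥ 1` and `x ≥ 0`,
`∫₀^x t^β e^{-t} L_n^β(t) dt = (1/n) · x^{β+1} e^{-x} L_{n-1}^{β+1}(x)`. -/
theorem integral_rpow_mul_exp_mul_genLaguerre
    (β : ℝ) (hβ : -1 < β) (n : ℕ) (hn : 1 ≤ n) (x : ℝ) (hx : 0 ≤ x) :
    ∫ t in (0 : ℝ)..x, t ^ β * Real.exp (-t) * genLaguerre β n t =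
      (1 / n) * (x ^ (β + 1) * Real.exp (-x) * genLaguerre (β + 1) (n - 1) x) := by
  obtain ⟨m, rfl⟩ := Nat.exists_eq_add_of_le' hn
  have hm : (m + 1 : ℝ) ≠ 0 := by positivity
  have hint : IntervalIntegrable
      (fun t => (m + 1 : ℝ) * (t ^ β * Real.exp (-t) * genLaguerre β (m + 1) t))
      volume 0 x := by
    have hc : Continuous fun t => Real.exp (-t) * genLaguerre β (m + 1) t :=
      (Real.continuous_exp.comp continuous_neg).mul (continuous_genLaguerre β (m + 1))
    simpa only [mul_assoc] using
      ((intervalIntegral.intervalIntegrable_rpow' hβ).mul_continuousOn hc.continuousOn).const_mul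
        (m + 1 : ℝ)
  have hcont : Continuous
      fun t => t ^ (β + 1) * Real.exp (-t) * genLaguerre (β + 1) m t :=
    ((Real.continuous_rpow_const (by linarith)).mul
      (Real.continuous_exp.comp continuous_neg)).mul (continuous_genLaguerre (β + 1) m)
  have key := intervalIntegral.integral_eq_sub_of_hasDerivAt_of_le hx hcont.continuousOn
    (fun t ht => hasDerivAt_rpow_mul_exp_mul_genLaguerre hβ m ht.1) hint
  rw [intervalIntegral.integral_const_mul, Real.zero_rpow (by linarith : β + 1 ≠ 0)] at key
  simp only [zero_mul, sub_zero] at key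
  rw [Nat.add_sub_cancel, ← key]
  push_cast
  field_simp
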